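/- Let k be a field of characteristic different from 2. Then k is pythagorean if and only if the following cancellation property holds: for every integer n ≥ 1 and all nondegenerate quadratic forms q and q' on finite-dimensional k-vector spaces of the same dimension, if the n-fold orthogonal sum of copies of q is isometric to the n-fold orthogonal sum of copies of q', then q is isometric to q'. (This property is equivalent to the Grothendieck–Witt group GW(k) being torsion free as an abelian group.) -/

import Mathlib

/-- A field `k` is pythagorean if every sum of two squares in `k` is a square. -/
def IsPythagorean (k : Type) [Field k] : Prop :=
  ∀ a b : k, ∃ c : k, a ^ 2 + b ^ 2 = c ^ 2

namespace QuadraticMap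

section Witt

variable {k V V₁ V₂ : Type*} [Field k] [AddCommGroup V] [Module k V]
  [AddCommGroup V₁] [Module k V₁] [AddCommGroup V₂] [Module k V₂]

/-- The quadratic form `x ↦ a * x ^ 2` on the one-dimensional space `k`. -/
abbrev rankOne (a : k) : QuadraticForm k k := a • sq

/-- An anisotropic vector `u` of a quadratic space yields an orthogonal reflection. -/
theorem exists_isometryEquiv_reflection (Q : QuadraticForm k V) {u : V} (hu : Q u ≠ 0) :
    ∃ e : Q.IsometryEquiv Q, ∀ x, e x = x - ((Q u)⁻¹ * polar Q u x) • u := by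
  have hf : ((Q u)⁻¹ • Q.polarBilin u) u = 2 := by
    simp [hu, mul_left_comm]
  refine ⟨⟨Module.reflection hf, fun x => ?_⟩, fun x => ?_⟩
  · change Q (Module.reflection hf x) = Q x
    rw [Module.reflection_apply, sub_eq_add_neg, QuadraticMap.map_add Q, QuadraticMap.map_neg,
      QuadraticMap.map_smul, polar_neg_right, polar_smul_right, polar_comm Q x u]
    simp
    field_simp
    ring
  · change Module.reflection hf x = _
    simp [Module.reflection_apply]

/-- The orthogonal group acts transitively on the vectors of a given nonzero length. -/
theorem exists_isometryEquiv_apply_eq (hchar : (2 : k) ≠ 0) (Q : QuadraticForm k V) {x y : V}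
    (hx : Q x ≠ 0) (hxy : Q x = Q y) : ∃ e : Q.IsometryEquiv Q, e x = y := by
  have hadd : Q (x + y) = 2 * Q x + polar Q x y := by
    rw [QuadraticMap.map_add Q, ← hxy]; ring
  have hsub : Q (x - y) = 2 * Q x - polar Q x y := by
    rw [sub_eq_add_neg, QuadraticMap.map_add Q, QuadraticMap.map_neg, polar_neg_right, ← hxy]; ring
  by_cases h : Q (x - y) = 0
  · have h' : Q (x + y) ≠ 0 := by
      intro h'
      have h4 : (2 * 2) * Q x = 0 := by linear_combination h + h' - hadd - hsub
      exact mul_ne_zero (mul_ne_zero hchar hchar) hx h4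
    obtain ⟨e, he⟩ := exists_isometryEquiv_reflection Q h'
    let neg : Q.IsometryEquiv Q := ⟨LinearEquiv.neg k, fun v => Q.map_neg v⟩
    refine ⟨e.trans neg, ?_⟩
    change -(e x) = y
    have hp : polar Q (x + y) x = Q (x + y) := by
      rw [polar_add_left, polar_self, polar_comm Q y x, hadd]; simp
    rw [he, hp, inv_mul_cancel₀ h']
    module
  · obtain ⟨e, he⟩ := exists_isometryEquiv_reflection Q h
    refine ⟨e, ?_⟩
    have hp : polar Q (x - y) x = Q (x - y) := by
      rw [polar_sub_left, polar_self, polar_comm Q y x, hsub]; simp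
    rw [he, hp, inv_mul_cancel₀ h]
    module

theorem snd_isometryEquiv_of_fixes {a : k} (hchar : (2 : k) ≠ 0) (ha : a ≠ 0)
    {Q₁ : QuadraticForm k V₁} {Q₂ : QuadraticForm k V₂}
    (e : ((rankOne a).prod Q₁).IsometryEquiv ((rankOne a).prod Q₂)) (he : e (1, 0) = (1, 0))
    (w : V₁) : e (0, w) = (0, (e (0, w)).2) := by
  have h : polar ((rankOne a).prod Q₂) (e (1, 0)) (e (0, w)) = 0 := by
    simp only [polar, ← map_add, e.map_app]
    simp
  rw [he] at h
  refine Prod.ext ?_ rfl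
  rw [polar_prod] at h
  simp [polar] at h
  have h2 : 2 * a * (e (0, w)).1 = 0 := by linear_combination h
  simpa [hchar, ha] using h2

/-- **Witt cancellation** for a one-dimensional summand. -/
theorem Equivalent.of_rankOne_prod {a : k} (hchar : (2 : k) ≠ 0) (ha : a ≠ 0)
    {Q₁ : QuadraticForm k V₁} {Q₂ : QuadraticForm k V₂}
    (h : ((rankOne a).prod Q₁).Equivalent ((rankOne a).prod Q₂)) : Q₁.Equivalent Q₂ := by
  obtain ⟨f⟩ := h
  have hf : ((rankOne a).prod Q₂) (f (1, 0)) = a := by rw [f.map_app]; simp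
  obtain ⟨g, hg⟩ := exists_isometryEquiv_apply_eq hchar ((rankOne a).prod Q₂)
    (x := f (1, 0)) (y := (1, 0)) (by rwa [hf]) (by rw [hf]; simp)
  let e := f.trans g
  have he : e (1, 0) = (1, 0) := hg
  have he' : e.symm (1, 0) = (1, 0) := by
    rw [← he]; exact e.toLinearEquiv.symm_apply_apply _
  refine ⟨⟨LinearEquiv.ofLinearMap
    (LinearMap.snd k k V₂ ∘ₗ e.toLinearEquiv.toLinearMap ∘ₗ LinearMap.inr k k V₁)
    (LinearMap.snd k k V₁ ∘ₗ e.symm.toLinearEquiv.toLinearMap ∘ₗ LinearMap.inr k k V₂)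
    ?_ ?_, ?_⟩⟩
  · ext w
    change (e (0, (e.symm (0, w)).2)).2 = w
    rw [← snd_isometryEquiv_of_fixes hchar ha e.symm he']
    exact congrArg Prod.snd (e.toLinearEquiv.apply_symm_apply (0, w))
  · ext w
    change (e.symm (0, (e (0, w)).2)).2 = w
    rw [← snd_isometryEquiv_of_fixes hchar ha e he]
    exact congrArg Prod.snd (e.toLinearEquiv.symm_apply_apply (0, w))
  · intro w
    change Q₂ (e (0, w)).2 = Q₁ w
    have h := e.map_app (0, w)
    rw [snd_isometryEquiv_of_fixes hchar ha e he w] at h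
    simpa using h

/-- `Fin.consLinearEquiv` as an isometry. -/
theorem equivalent_pi_succ (Q : QuadraticForm k V) (n : ℕ) :
    (Q.prod (pi fun _ : Fin n => Q)).Equivalent (pi fun _ : Fin (n + 1) => Q) :=
  ⟨⟨Fin.consLinearEquiv k fun _ => V, fun x => by
    simp [Fin.sum_univ_succ]⟩⟩

theorem equivalent_prod_assoc (Q : QuadraticForm k V) (Q₁ : QuadraticForm k V₁)
    (Q₂ : QuadraticForm k V₂) : ((Q.prod Q₁).prod Q₂).Equivalent (Q.prod (Q₁.prod Q₂)) :=
  ⟨⟨LinearEquiv.prodAssoc k V V₁ V₂, fun x => by simp [add_assoc]⟩⟩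

theorem equivalent_pi_empty_prod {ι : Type*} [Fintype ι] [IsEmpty ι] (Q₁ : QuadraticForm k V₁)
    (Q₂ : QuadraticForm k V₂) : ((QuadraticMap.pi fun _ : ι => Q₁).prod Q₂).Equivalent Q₂ :=
  ⟨⟨LinearEquiv.uniqueProd, fun x => by simp⟩⟩

theorem equivalent_prod_pi_prod (Q₁ : QuadraticForm k V₁) (Q₂ : QuadraticForm k V₂) (n : ℕ) :
    (Q₁.prod ((QuadraticMap.pi fun _ : Fin n => Q₁).prod Q₂)).Equivalent
      ((QuadraticMap.pi fun _ : Fin (n + 1) => Q₁).prod Q₂) :=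
  (equivalent_prod_assoc _ _ _).symm.trans ((equivalent_pi_succ Q₁ n).prod (.refl Q₂))

theorem Equivalent.of_pi_rankOne_prod {a : k} (hchar : (2 : k) ≠ 0) (ha : a ≠ 0)
    {Q₁ : QuadraticForm k V₁} {Q₂ : QuadraticForm k V₂} (n : ℕ)
    (h : ((QuadraticMap.pi fun _ : Fin n => rankOne a).prod Q₁).Equivalent
      ((QuadraticMap.pi fun _ : Fin n => rankOne a).prod Q₂)) : Q₁.Equivalent Q₂ := by
  induction n with
  | zero =>
    exact (equivalent_pi_empty_prod _ Q₁).symm.trans (h.trans (equivalent_pi_empty_prod _ Q₂))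
  | succ n ih =>
    exact ih (((equivalent_prod_pi_prod _ Q₁ n).trans
      (h.trans (equivalent_prod_pi_prod _ Q₂ n).symm)).of_rankOne_prod hchar ha)

theorem equivalent_pi_prod {ι : Type*} [Fintype ι] (Q₁ : QuadraticForm k V₁)
    (Q₂ : QuadraticForm k V₂) :
    (pi fun _ : ι => Q₁.prod Q₂).Equivalent ((pi fun _ : ι => Q₁).prod (pi fun _ : ι => Q₂)) :=
  ⟨⟨LinearEquiv.ofLinearMap
    (LinearMap.prod (LinearMap.pi fun i => LinearMap.fst k V₁ V₂ ∘ₗ LinearMap.proj i)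
      (LinearMap.pi fun i => LinearMap.snd k V₁ V₂ ∘ₗ LinearMap.proj i))
    (LinearMap.pi fun i => LinearMap.prod (LinearMap.proj i ∘ₗ LinearMap.fst k _ _)
      (LinearMap.proj i ∘ₗ LinearMap.snd k _ _)) rfl rfl,
    fun x => by
      change ((pi fun _ : ι => Q₁).prod (pi fun _ : ι => Q₂))
        (fun i => (x i).1, fun i => (x i).2) = _
      simp [Finset.sum_add_distrib]⟩⟩

/-- An anisotropic vector splits off as an orthogonal summand. -/
theorem exists_equivalent_rankOne_prod (hchar : (2 : k) ≠ 0) (Q : QuadraticForm k V) {v : V}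
    (hv : Q v ≠ 0) :
    ∃ W : Submodule k V, ((rankOne (Q v)).prod (Q.comp W.subtype)).Equivalent Q := by
  let W := LinearMap.ker (Q.polarBilin v)
  let f : k × W →ₗ[k] V := (LinearMap.toSpanSingleton k V v).coprod W.subtype
  have hf (x : k × W) : f x = x.1 • v + x.2 := rfl
  have hW (w : W) : polar Q v w = 0 := w.2
  refine ⟨W, ⟨⟨LinearEquiv.ofBijective f ⟨?_, fun y => ?_⟩, fun x => ?_⟩⟩⟩
  · rw [injective_iff_map_eq_zero]
    rintro ⟨t, w⟩ h
    rw [hf] at h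
    have h1 : polar Q v (t • v + w) = 0 := by rw [h, polar_zero_right]
    rw [polar_add_right, hW, polar_smul_right, polar_self] at h1
    obtain rfl : t = 0 := by simpa [hchar, hv] using h1
    simpa using h
  · let t := (2 * Q v)⁻¹ * polar Q v y
    refine ⟨(t, ⟨y - t • v, ?_⟩), by simp [hf]⟩
    change polar Q v (y - t • v) = 0
    rw [polar_sub_right, polar_smul_right, polar_self]
    simp [t]
    field_simp
    ring
  · change Q (f x) = _
    rw [hf, QuadraticMap.map_add Q, polar_smul_left, hW, QuadraticMap.map_smul]
    simp
    ring

end Witt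

end QuadraticMap

namespace IsPythagorean

open QuadraticMap

variable {k : Type} [Field k]

theorem exists_sq_eq_sum (hk : IsPythagorean k) {ι : Type*} (s : Finset ι) (f : ι → k) :
    ∃ c, ∑ i ∈ s, f i ^ 2 = c ^ 2 := by
  classical
  induction s using Finset.induction_on with
  | empty => exact ⟨0, by simp⟩
  | insert i s hi ih =>
    obtain ⟨c, hc⟩ := ih
    rw [Finset.sum_insert hi, hc]
    exact hk _ _

/-- Over a pythagorean field a multiple of a quadratic form represents no new values. -/
theorem exists_apply_eq_pi (hk : IsPythagorean k) (hchar : (2 : k) ≠ 0) {V ι : Type*}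
    [AddCommGroup V] [Module k V] [FiniteDimensional k V] [Fintype ι] (Q : QuadraticForm k V)
    (x : ι → V) : ∃ y, Q y = pi (fun _ : ι => Q) x := by
  let _ : Invertible (2 : k) := invertibleOfNonzero hchar
  obtain ⟨w, ⟨e⟩⟩ := Q.equivalent_weightedSumSquares
  choose c hc using fun j => hk.exists_sq_eq_sum Finset.univ fun i => e (x i) j
  refine ⟨e.symm c, ?_⟩
  rw [e.symm.map_app, weightedSumSquares_apply, pi_apply]
  simp only [← e.map_app, weightedSumSquares_apply, ← pow_two, ← hc, Finset.smul_sum]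
  exact Finset.sum_comm

theorem exists_apply_eq_of_equivalent_pi (hk : IsPythagorean k) (hchar : (2 : k) ≠ 0) {n : ℕ}
    (hn : 1 ≤ n) {V V' : Type*} [AddCommGroup V] [Module k V]
    [AddCommGroup V'] [Module k V'] [FiniteDimensional k V']
    {q : QuadraticForm k V} {q' : QuadraticForm k V'}
    (h : (pi fun _ : Fin n => q).Equivalent (pi fun _ : Fin n => q')) (v : V) :
    ∃ v', q' v' = q v := by
  obtain ⟨e⟩ := h
  obtain ⟨v', hv'⟩ := hk.exists_apply_eq_pi hchar q' (e (Pi.single ⟨0, hn⟩ v))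
  exact ⟨v', by rw [hv', e.map_app, pi_apply_single]⟩

theorem equivalent_of_equivalent_pi (hk : IsPythagorean k) (hchar : (2 : k) ≠ 0) {n : ℕ}
    (hn : 1 ≤ n) {V V' : Type*} [AddCommGroup V] [Module k V] [FiniteDimensional k V]
    [AddCommGroup V'] [Module k V'] [FiniteDimensional k V']
    {q : QuadraticForm k V} {q' : QuadraticForm k V'}
    (hdim : Module.finrank k V = Module.finrank k V')
    (h : (pi fun _ : Fin n => q).Equivalent (pi fun _ : Fin n => q')) : q.Equivalent q' := by
  induction hd : Module.finrank k V generalizing V V' with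
  | zero =>
    have := Module.finrank_zero_iff.1 hd
    have := Module.finrank_zero_iff.1 (hdim ▸ hd)
    exact ⟨⟨LinearEquiv.ofFinrankEq V V' hdim, fun x => by
      rw [Subsingleton.elim x 0]; simp⟩⟩
  | succ d ih =>
    by_cases hq : ∃ v, q v ≠ 0
    · obtain ⟨v, hv⟩ := hq
      obtain ⟨v', hv'⟩ := hk.exists_apply_eq_of_equivalent_pi hchar hn h v
      obtain ⟨W, hW⟩ := exists_equivalent_rankOne_prod hchar q hv
      obtain ⟨W', hW'⟩ := exists_equivalent_rankOne_prod hchar q' (hv' ▸ hv)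
      rw [hv'] at hW'
      have hr : 1 + Module.finrank k W = Module.finrank k V := by
        simpa using hW.some.toLinearEquiv.finrank_eq
      have hr' : 1 + Module.finrank k W' = Module.finrank k V' := by
        simpa using hW'.some.toLinearEquiv.finrank_eq
      have hWW' : (q.comp W.subtype).Equivalent (q'.comp W'.subtype) := by
        refine ih (by omega) (Equivalent.of_pi_rankOne_prod hchar hv n ?_) (by omega)
        exact (equivalent_pi_prod _ _).symm.trans <| (Equivalent.pi fun _ => hW).trans <|
          h.trans <| (Equivalent.pi fun _ => hW'.symm).trans (equivalent_pi_prod _ _)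
      exact hW.symm.trans (((Equivalent.refl _).prod hWW').trans hW')
    · push Not at hq
      have hq' (v' : V') : q' v' = 0 := by
        obtain ⟨v, hv⟩ := hk.exists_apply_eq_of_equivalent_pi hchar hn h.symm v'
        rw [← hv, hq]
      exact ⟨⟨LinearEquiv.ofFinrankEq V V' hdim, fun x => by rw [hq, hq']⟩⟩

end IsPythagorean

namespace QuadraticMap

variable {k : Type*} [Field k]

theorem nondegenerate_polarBilin_rankOne (hchar : (2 : k) ≠ 0) {a : k} (ha : a ≠ 0) :
    LinearMap.BilinForm.Nondegenerate (polarBilin (rankOne a)) := by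
  have key (x : k) (h : polar (rankOne a) x 1 = 0) : x = 0 := by
    simp [polar] at h
    have h2 : 2 * a * x = 0 := by linear_combination h
    simpa [hchar, ha] using h2
  exact ⟨fun x h => key x (h 1), fun x h => key x (polar_comm (rankOne a) x 1 ▸ h 1)⟩

/-- A nonzero sum of two squares `s` satisfies `⟨1, 1⟩ ≅ ⟨s, s⟩`. -/
theorem equivalent_pi_rankOne_add_sq {a b : k} (h : a ^ 2 + b ^ 2 ≠ 0) :
    (pi fun _ : Fin 2 => rankOne (a ^ 2 + b ^ 2)).Equivalent
      (pi fun _ : Fin 2 => rankOne (1 : k)) := by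
  let M : Matrix (Fin 2) (Fin 2) k := !![a, -b; b, a]
  have hM : M.det ≠ 0 := by
    convert h using 1
    simp [M, Matrix.det_fin_two]
    ring
  refine ⟨⟨M.toLin'.equivOfDetNeZero (by simpa using hM), fun x => ?_⟩⟩
  change (pi fun _ : Fin 2 => rankOne (1 : k)) (M.toLin' x) = _
  simp [M, Matrix.toLin'_apply, Fin.sum_univ_two, dotProduct]
  ring

end QuadraticMap

/-- Let `k` be a field of characteristic different from 2. Then `k` is pythagorean if and
only if for every `n ≥ 1` and all nondegenerate quadratic forms `q`, `q'` on
finite-dimensional `k`-vector spaces of the same dimension, if the `n`-fold orthogonal sums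
of copies of `q` and of `q'` are isometric, then `q` and `q'` are isometric. -/
theorem stmt_0 {k : Type} [Field k] (hchar : (2 : k) ≠ 0) :
    IsPythagorean k ↔
      ∀ (n : ℕ), 1 ≤ n →
        ∀ (V V' : Type) [AddCommGroup V] [Module k V] [FiniteDimensional k V]
          [AddCommGroup V'] [Module k V'] [FiniteDimensional k V'],
          ∀ (q : QuadraticForm k V) (q' : QuadraticForm k V'),
            LinearMap.BilinForm.Nondegenerate (QuadraticMap.polarBilin q) →
            LinearMap.BilinForm.Nondegenerate (QuadraticMap.polarBilin q') →
            Module.finrank k V = Module.finrank k V' →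
            QuadraticMap.Equivalent (QuadraticMap.pi fun _ : Fin n => q)
              (QuadraticMap.pi fun _ : Fin n => q') →
            QuadraticMap.Equivalent q q' := by
  refine ⟨fun hk n hn V V' _ _ _ _ _ _ q q' _ _ hdim h =>
    hk.equivalent_of_equivalent_pi hchar hn hdim h, fun H a b => ?_⟩
  by_cases hs : a ^ 2 + b ^ 2 = 0
  · exact ⟨0, by simp [hs]⟩
  obtain ⟨e⟩ := H 2 one_le_two k k (QuadraticMap.rankOne (a ^ 2 + b ^ 2)) (QuadraticMap.rankOne 1)
    (QuadraticMap.nondegenerate_polarBilin_rankOne hchar hs)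
    (QuadraticMap.nondegenerate_polarBilin_rankOne hchar one_ne_zero) rfl
    (QuadraticMap.equivalent_pi_rankOne_add_sq hs)
  refine ⟨e 1, ?_⟩
  have h := e.map_app 1
  simp at h
  linear_combination -h
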